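/- arXiv:1309.5131 — 3 statements merged into one kernel-verified Lean document; each statement's English description precedes it below -/
import Mathlib

section
/- Let O be an index set of observation points and, for each j ∈ O, let R_j ⊆ Σ × Σ be the j-th reachability relation of the program, with post_j(X) := {t | ∃ s ∈ X, R_j s t}. Then trace-based non-interference holds — ∀ j ∈ O, ∀ s₁ s₂ : Σ, s₁° = s₂° → (post_j {s₁})° = (post_j {s₂})° — if and only if for every j ∈ O the abstraction 𝓗 is backward complete for post_j, i.e., ∀ j ∈ O, ∀ X : Set Σ, 𝓗(post_j(𝓗(X))) = 𝓗(post_j(X)). -/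
/-- The abstraction `𝓗` pairing each observable value occurring in `X`
with all internal values. -/
def HH {H L : Type*} (X : Set (H × L)) : Set (H × L) :=
  Set.univ ×ˢ (Prod.snd '' X)

/-- The strongest-postcondition map of a relation `R`. -/
def post {σ : Type*} (R : σ → σ → Prop) (X : Set σ) : Set σ :=
  {t | ∃ s ∈ X, R s t}

theorem mem_HH {H L : Type*} {X : Set (H × L)} {t : H × L} :
    t ∈ HH X ↔ t.2 ∈ Prod.snd '' X := by
  simp [HH]

theorem subset_HH {H L : Type*} (X : Set (H × L)) : X ⊆ HH X :=
  fun s hs => mem_HH.2 ⟨s, hs, rfl⟩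

theorem snd_image_HH {H L : Type*} [Nonempty H] (X : Set (H × L)) :
    Prod.snd '' HH X = Prod.snd '' X :=
  Set.snd_image_prod Set.univ_nonempty _

theorem HH_congr {H L : Type*} {X Y : Set (H × L)} (h : Prod.snd '' X = Prod.snd '' Y) :
    HH X = HH Y := by
  rw [HH, HH, h]

theorem post_mono {σ : Type*} (R : σ → σ → Prop) : Monotone (post R) :=
  fun _ _ h _ ⟨s, hs, hR⟩ => ⟨s, h hs, hR⟩

/-- Trace-based non-interference w.r.t. a family of reachability relations
indexed by observation points holds iff `𝓗` is backward complete for every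
`post_j`, `j ∈ O`. -/
theorem trace_ni_iff_backward_complete {H L J : Type*} (O : Set J)
    (R : J → (H × L) → (H × L) → Prop) :
    (∀ j ∈ O, ∀ s₁ s₂ : H × L, s₁.2 = s₂.2 →
        Prod.snd '' post (R j) ({s₁} : Set (H × L)) =
          Prod.snd '' post (R j) ({s₂} : Set (H × L))) ↔
      (∀ j ∈ O, ∀ X : Set (H × L),
        HH (post (R j) (HH X)) = HH (post (R j) X)) := by
  constructor
  · intro hNI j hj X
    refine HH_congr (Set.Subset.antisymm ?_ (Set.image_mono (post_mono _ (subset_HH X))))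
    rintro _ ⟨t, ⟨s, hs, hR⟩, rfl⟩
    obtain ⟨s', hs', hss'⟩ := mem_HH.1 hs
    have ht : t.2 ∈ Prod.snd '' post (R j) {s} := ⟨t, ⟨s, rfl, hR⟩, rfl⟩
    rw [hNI j hj s s' hss'.symm] at ht
    exact Set.image_mono (post_mono _ (Set.singleton_subset_iff.2 hs')) ht
  · intro hBC j hj s₁ s₂ h
    have : Nonempty H := ⟨s₁.1⟩
    have hs : HH ({s₁} : Set (H × L)) = HH {s₂} := HH_congr (by simp [h])
    rw [← snd_image_HH, ← hBC j hj, hs, hBC j hj, snd_image_HH]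
end

section
/- Let η : Set Σ → Set Σ be the attribute-independent partitioning input observation determined by equivalence relations ≈_H on H and ≈_L on L, i.e., η(X) := ⋃_{(h,l) ∈ X} [h]_{≈_H} ×ˢ [l]_{≈_L}, and let ρ : Set Σ → Set Σ observe only public data, ρ(Y) := Set.univ ×ˢ ρ_∘(Y°), where ρ_∘ is a partitioning upper closure operator on Set L. Define the best correct approximation of the semantics f^{η,ρ} := ρ ∘ F ∘ η. Then the program satisfies abstract non-interference — ∀ x₁ x₂ : Σ, x₁° = x₂° → ρ(F(η({x₁}))) = ρ(F(η({x₂}))) — if and only if 𝓗 is backward complete for f^{η,ρ}, i.e., ∀ X : Set Σ, 𝓗(f^{η,ρ}(𝓗 X)) = 𝓗(f^{η,ρ}(X)). -/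
theorem mem_HH_s8 {H L : Type*} {X : Set (H × L)} {p : H × L} :
    p ∈ HH X ↔ ∃ x ∈ X, x.2 = p.2 := by
  simp [HH]

theorem HH_univ_prod {H L : Type*} (S : Set L) :
    HH (Set.univ ×ˢ S : Set (H × L)) = Set.univ ×ˢ S := by
  ext ⟨h, l⟩
  rw [mem_HH_s8]
  constructor
  · rintro ⟨x, hx, rfl⟩
    exact ⟨trivial, hx.2⟩
  · intro hl
    exact ⟨(h, l), hl, rfl⟩

theorem HH_singleton_congr {H L : Type*} {x y : H × L} (h : x.2 = y.2) :
    HH {x} = HH {y} := by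
  simp [HH, h]

/-- For an additive operator with `𝓗`-closed values, backward completeness of `𝓗` amounts to
the values on singletons depending on the observable part only. -/
theorem singleton_congr_iff_backward_complete {H L : Type*}
    (G : Set (H × L) → Set (H × L)) (hadd : ∀ X, G X = ⋃ x ∈ X, G {x})
    (hclosed : ∀ X, HH (G X) = G X) :
    (∀ x₁ x₂ : H × L, x₁.2 = x₂.2 → G {x₁} = G {x₂}) ↔
      (∀ X : Set (H × L), HH (G (HH X)) = HH (G X)) := by
  simp only [hclosed]
  constructor
  · intro hG X
    rw [hadd (HH X), hadd X]
    ext p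
    simp only [Set.mem_iUnion, exists_prop]
    constructor
    · rintro ⟨y, hy, hp⟩
      obtain ⟨x, hx, hxy⟩ := mem_HH_s8.1 hy
      exact ⟨x, hx, hG x y hxy ▸ hp⟩
    · rintro ⟨x, hx, hp⟩
      exact ⟨x, mem_HH_s8.2 ⟨x, hx, rfl⟩, hp⟩
  · intro hG x₁ x₂ h
    rw [← hG {x₁}, HH_singleton_congr h, hG]

/-- Abstract non-interference w.r.t. a partitioning attribute-independent input
observation `η` and a public-output observation `ρ` holds iff `𝓗` is backward
complete for the best correct approximation `ρ ∘ F ∘ η` of the semantics. -/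
theorem ani_iff_backward_complete_bca {H L : Type*} (f : H × L → H × L)
    (rH : Setoid H) (rL : Setoid L)
    (η : Set (H × L) → Set (H × L))
    (hη : ∀ X : Set (H × L),
      η X = ⋃ x ∈ X, ({h | rH.r h x.1} ×ˢ {l | rL.r l x.2} : Set (H × L)))
    (rρ : Setoid L)
    (ρ₀ : Set L → Set L) (hρ₀ : ∀ S : Set L, ρ₀ S = {b | ∃ a ∈ S, rρ.r b a})
    (ρ : Set (H × L) → Set (H × L))
    (hρ : ∀ Y : Set (H × L), ρ Y = Set.univ ×ˢ ρ₀ (Prod.snd '' Y)) :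
    (∀ x₁ x₂ : H × L, x₁.2 = x₂.2 →
        ρ (f '' η {x₁}) = ρ (f '' η {x₂})) ↔
      (∀ X : Set (H × L), HH (ρ (f '' η (HH X))) = HH (ρ (f '' η X))) := by
  refine singleton_congr_iff_backward_complete (fun X => ρ (f '' η X)) (fun X => ?_) (fun X => ?_)
  · ext ⟨h, l⟩
    simp only [hρ, hρ₀, hη, Set.mem_prod, Set.mem_univ, true_and, Set.mem_ofPred_eq,
      Set.mem_image, Set.mem_iUnion, Set.mem_singleton_iff, exists_prop, exists_eq_left]
    constructor
    · rintro ⟨_, ⟨_, ⟨y, ⟨x, hx, hyx⟩, rfl⟩, rfl⟩, hl⟩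
      exact ⟨x, hx, _, ⟨_, ⟨y, hyx, rfl⟩, rfl⟩, hl⟩
    · rintro ⟨x, hx, _, ⟨_, ⟨y, hyx, rfl⟩, rfl⟩, hl⟩
      exact ⟨_, ⟨_, ⟨y, ⟨x, hx, hyx⟩, rfl⟩, rfl⟩, hl⟩
  · simp only [hρ, HH_univ_prod]
end

section
/- Let φ_* be a partitioning upper closure operator on Set H and φ_∘ a partitioning upper closure operator on Set L, with declassification abstraction 𝓗_φ(X) := ⋃_{o ∈ X°} φ_*({h | (h, o) ∈ X}) ×ˢ φ_∘({o}), and let ρ_∘ be an additive upper closure operator on Set L with 𝓗_ρ(X) := Set.univ ×ˢ ρ_∘(X°). Then the program satisfies declassified abstract non-interference for a dynamic attacker — ∀ x₁ x₂ : Σ, φ_*({x₁.1}) = φ_*({x₂.1}) → φ_∘({x₁.2}) = φ_∘({x₂.2}) → ρ_∘({(f x₁)°}) = ρ_∘({(f x₂)°}) — if and only if ∀ X : Set Σ, 𝓗_ρ(F(𝓗_φ X)) = 𝓗_ρ(F X). -/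
/-- The abstraction `𝓗_ρ` determined by a public-output observation `ρ₀`. -/
def HHrho {H L : Type*} (ρ₀ : Set L → Set L) (X : Set (H × L)) : Set (H × L) :=
  Set.univ ×ˢ ρ₀ (Prod.snd '' X)

/-- Equality of singleton classes under a partitioning closure is the underlying relation. -/
theorem partitioning_singleton_eq_iff {A : Type*} (r : Setoid A) (φ : Set A → Set A)
    (hφ : ∀ S : Set A, φ S = {b | ∃ a ∈ S, r.r b a}) (a b : A) :
    φ {a} = φ {b} ↔ r.r a b := by
  simp only [hφ, Set.mem_singleton_iff, exists_eq_left, Set.ext_iff, Set.mem_ofPred_eq]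
  exact ⟨fun h => (h a).1 (r.refl a),
    fun h c => ⟨fun hc => r.trans hc h, fun hc => r.trans hc (r.symm h)⟩⟩

/-- An additive set operator is determined by its values on singletons. -/
theorem mem_additive_iff {A : Type*} (ρ : Set A → Set A)
    (hadd : ∀ 𝒮 : Set (Set A), ρ (⋃₀ 𝒮) = ⋃₀ (ρ '' 𝒮)) (S : Set A) (y : A) :
    y ∈ ρ S ↔ ∃ s ∈ S, y ∈ ρ {s} := by
  have h := hadd ((fun s => {s}) '' S)
  rw [Set.sUnion_image, Set.biUnion_of_singleton] at h
  simp [h]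

theorem HHrho_eq_iff {H L : Type*} [Nonempty H] (ρ₀ : Set L → Set L) (X Y : Set (H × L)) :
    HHrho ρ₀ X = HHrho ρ₀ Y ↔ ρ₀ (Prod.snd '' X) = ρ₀ (Prod.snd '' Y) := by
  refine ⟨fun h => ?_, fun h => by rw [HHrho, HHrho, h]⟩
  simpa [HHrho, Set.snd_image_prod Set.univ_nonempty] using congrArg (Prod.snd '' ·) h

/-- Declassified abstract non-interference for a dynamic attacker (additive
output uco `ρ₀`, partitioning declassification ucos `φ_*`, `φ_∘`) holds iff
`∀ X, 𝓗_ρ(F(𝓗_φ X)) = 𝓗_ρ(F X)`. -/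
theorem dani_dynamic_iff {H L : Type*} (f : H × L → H × L)
    (rH : Setoid H) (φs : Set H → Set H)
    (hφs : ∀ S : Set H, φs S = {b | ∃ a ∈ S, rH.r b a})
    (rL : Setoid L) (φo : Set L → Set L)
    (hφo : ∀ S : Set L, φo S = {b | ∃ a ∈ S, rL.r b a})
    (Hφ : Set (H × L) → Set (H × L))
    (hHφ : ∀ X : Set (H × L),
      Hφ X = ⋃ o ∈ Prod.snd '' X, (φs {h | (h, o) ∈ X} ×ˢ φo {o} : Set (H × L)))
    (ρ₀ : Set L → Set L) (hmono : Monotone ρ₀)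
    (hidem : ∀ S : Set L, ρ₀ (ρ₀ S) = ρ₀ S)
    (hext : ∀ S : Set L, S ⊆ ρ₀ S)
    (hadd : ∀ 𝒮 : Set (Set L), ρ₀ (⋃₀ 𝒮) = ⋃₀ (ρ₀ '' 𝒮)) :
    (∀ x₁ x₂ : H × L, φs {x₁.1} = φs {x₂.1} → φo {x₁.2} = φo {x₂.2} →
        ρ₀ {(f x₁).2} = ρ₀ {(f x₂).2}) ↔
      (∀ X : Set (H × L), HHrho ρ₀ (f '' Hφ X) = HHrho ρ₀ (f '' X)) := by
  have hmem : ∀ X p, p ∈ Hφ X ↔ ∃ x ∈ X, rH.r p.1 x.1 ∧ rL.r p.2 x.2 := by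
    rintro X ⟨h, l⟩
    simp only [hHφ, hφs, hφo, Set.mem_iUnion, Set.mem_prod, Set.mem_ofPred_eq,
      Set.mem_singleton_iff, exists_eq_left, exists_prop]
    constructor
    · rintro ⟨o, -, ⟨a, ha, hr⟩, hl⟩
      exact ⟨(a, o), ha, hr, hl⟩
    · rintro ⟨x, hx, hr, hl⟩
      exact ⟨x.2, ⟨x, hx, rfl⟩, ⟨x.1, hx, hr⟩, hl⟩
  simp only [partitioning_singleton_eq_iff rH φs hφs, partitioning_singleton_eq_iff rL φo hφo]
  constructor
  · intro hni X
    unfold HHrho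
    congr 1
    ext y
    simp only [mem_additive_iff ρ₀ hadd (Prod.snd '' _), Set.exists_mem_image]
    constructor
    · rintro ⟨p, hp, hy⟩
      obtain ⟨x, hx, hr, hl⟩ := (hmem X p).1 hp
      exact ⟨x, hx, hni p x hr hl ▸ hy⟩
    · rintro ⟨x, hx, hy⟩
      exact ⟨x, (hmem X x).2 ⟨x, hx, rH.refl _, rL.refl _⟩, hy⟩
  · intro hc x₁ x₂ hr hl
    have : Nonempty H := ⟨x₁.1⟩
    have heq : Hφ {x₁} = Hφ {x₂} := by
      ext p
      simp only [hmem, Set.mem_singleton_iff, exists_eq_left]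
      exact ⟨fun h => ⟨rH.trans h.1 hr, rL.trans h.2 hl⟩,
        fun h => ⟨rH.trans h.1 (rH.symm hr), rL.trans h.2 (rL.symm hl)⟩⟩
    have h := hc {x₁}
    rw [heq, hc {x₂}, HHrho_eq_iff] at h
    simpa using h.symm
end
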